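/- (Lemma 2.1, Gaussian Wigner case with f(x,y) = −(1/2)(x−y)², closed forms and inequalities.) Fix ρ ∈ (0,1) and t > 0. Let (A,B) be a pair of standard Gaussians with correlation ρ. Then: (a) E[ exp( −(t/2)(A−B)² ) ] = (1 + 2t(1−ρ))^{−1/2}; for independent standard normal A, B, E[ exp( −(t/2)(A−B)² ) ] = (1 + 2t)^{−1/2}; and for two independent correlated pairs (A₀,B₀), (A₁,B₁), E[ exp( −(t/2)((A₀−B₁)² + (A₁−B₀)²) ) ] = ((1+2t)² − 4t²ρ²)^{−1/2}. (b) For an integer ℓ ≥ 1, define m_ℓ := E[ exp( −(t/2)·Σ_{i=1}^{ℓ} (A_{i−1}−B_i)² ) ] with ((A_i,B_i))_{i=0}^{ℓ} i.i.d. correlated pairs, and m̃_ℓ := E[ exp( −(t/2)·Σ_{i ∈ ℤ/ℓℤ} (A_i−B_{i+1})² ) ] with ((A_i,B_i))_{i ∈ ℤ/ℓℤ} i.i.d. correlated pairs; then m₁² ≤ m̃₂ ≤ m̃₁², m_ℓ < m̃_ℓ for every ℓ ≥ 1, and m̃_ℓ² ≤ m̃₂^ℓ for every ℓ ≥ 2.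 Moreover m̃_ℓ = (λ₁^{ℓ/2} − λ₂^{ℓ/2})^{−1} where λ₁ > λ₂ > 0 are the two roots of x² − (1+2t)x + t²ρ² = 0. -/

import Mathlib

open MeasureTheory ProbabilityTheory

namespace GaussMGF

/-- The standard Gaussian measure on `ℝ`. -/
noncomputable def stdGauss : Measure ℝ := gaussianReal 0 1

/-- The law of a pair of standard Gaussians with correlation `ρ`:
the distribution of `(A, ρ·A + √(1−ρ²)·Z)` for `A, Z` independent standard normal. -/
noncomputable def gaussPair (ρ : ℝ) : Measure (ℝ × ℝ) :=
  (stdGauss.prod stdGauss).map fun z => (z.1, ρ * z.1 + Real.sqrt (1 - ρ ^ 2) * z.2)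

/-- The Gaussian path MGF for `f(x,y) = −(1/2)(x−y)²`. -/
noncomputable def sqPathMGF (ρ t : ℝ) (ℓ : ℕ) : ℝ :=
  ∫ ω : Fin (ℓ + 1) → ℝ × ℝ,
    Real.exp (-(t / 2) * ∑ i : Fin ℓ, ((ω i.castSucc).1 - (ω i.succ).2) ^ 2)
    ∂(Measure.pi fun _ => gaussPair ρ)

/-- The Gaussian cycle MGF for `f(x,y) = −(1/2)(x−y)²`. -/
noncomputable def sqCycleMGF (ρ t : ℝ) (ℓ : ℕ) : ℝ :=
  ∫ ω : Fin ℓ → ℝ × ℝ,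
    Real.exp (-(t / 2) * ∑ i : Fin ℓ, ((ω i).1 - (ω (finRotate ℓ i)).2) ^ 2)
    ∂(Measure.pi fun _ => gaussPair ρ)

instance : IsProbabilityMeasure stdGauss := by
  unfold stdGauss; infer_instance

instance (ρ : ℝ) : IsProbabilityMeasure (gaussPair ρ) :=
  Measure.isProbabilityMeasure_map (by fun_prop)

theorem gaussPair_zero : gaussPair 0 = stdGauss.prod stdGauss := by
  simp [gaussPair]

/-- The Laplace transform of a nondegenerate quadratic function of a standard Gaussian. -/
theorem lintegral_exp_quadratic_stdGauss {a : ℝ} (b c : ℝ) (ha : 0 < 1 + a) :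
    ∫⁻ x, ENNReal.ofReal (Real.exp (-a / 2 * x ^ 2 + b * x + c)) ∂stdGauss =
      ENNReal.ofReal ((Real.sqrt (1 + a))⁻¹ * Real.exp (b ^ 2 / (2 * (1 + a)) + c)) := by
  have hpos : (0 : ℝ) < (1 + a) / 2 := by positivity
  have hdens : ∀ x, gaussianPDF 0 1 x * ENNReal.ofReal (Real.exp (-a / 2 * x ^ 2 + b * x + c)) =
      ENNReal.ofReal ((Real.sqrt (2 * Real.pi))⁻¹ * Real.exp (b ^ 2 / (2 * (1 + a)) + c)) *
        ENNReal.ofReal (Real.exp (-((1 + a) / 2) * (x - b / (1 + a)) ^ 2)) := by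
    intro x
    rw [gaussianPDF, gaussianPDFReal, ← ENNReal.ofReal_mul (by positivity),
      ← ENNReal.ofReal_mul (by positivity), mul_assoc (Real.sqrt _)⁻¹,
      mul_assoc (Real.sqrt _)⁻¹, ← Real.exp_add, ← Real.exp_add]
    simp only [NNReal.coe_one, mul_one, sub_zero]
    congr 3
    field_simp
    ring
  rw [stdGauss, gaussianReal_of_var_ne_zero _ one_ne_zero,
    lintegral_withDensity_eq_lintegral_mul _ (measurable_gaussianPDF 0 1) (by fun_prop)]
  simp only [Pi.mul_apply, hdens]
  rw [lintegral_const_mul _ (by fun_prop),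
    lintegral_sub_right_eq_self
      (fun x => ENNReal.ofReal (Real.exp (-((1 + a) / 2) * x ^ 2))) (b / (1 + a)),
    ← ofReal_integral_eq_lintegral_ofReal (integrable_exp_neg_mul_sq hpos)
      (Filter.Eventually.of_forall fun _ => (Real.exp_pos _).le),
    integral_gaussian, ← ENNReal.ofReal_mul (by positivity)]
  congr 1
  have hsqrt : Real.sqrt (Real.pi / ((1 + a) / 2)) =
      Real.sqrt (2 * Real.pi) * (Real.sqrt (1 + a))⁻¹ := by
    rw [← Real.sqrt_inv, ← Real.sqrt_mul (by positivity)]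
    congr 1
    field_simp
  have h2 : Real.sqrt (2 * Real.pi) ≠ 0 := by positivity
  rw [hsqrt]
  field_simp

/-- The Laplace transform of a quadratic function of a correlated Gaussian pair; `D` is
`det (1 + Σ M)` for the covariance matrix `Σ` and the matrix `M = !![α, -q; -q, β]`. -/
theorem lintegral_exp_quadratic_gaussPair {σ α β q D : ℝ} (u v k : ℝ) (hσ : σ ^ 2 ≤ 1)
    (hβ : 0 ≤ β) (hD : 0 < D)
    (hDeq : D = 1 + α + β - 2 * σ * q + (1 - σ ^ 2) * (α * β - q ^ 2)) :
    ∫⁻ c, ENNReal.ofReal (Real.exp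
        (-(α * c.1 ^ 2 - 2 * q * c.1 * c.2 + β * c.2 ^ 2) / 2 + u * c.1 + v * c.2 + k))
        ∂gaussPair σ =
      ENNReal.ofReal ((Real.sqrt D)⁻¹ * Real.exp
        ((u ^ 2 * (1 + (1 - σ ^ 2) * β) + 2 * u * v * (σ + (1 - σ ^ 2) * q)
          + v ^ 2 * (1 + (1 - σ ^ 2) * α)) / (2 * D) + k)) := by
  obtain ⟨τ, hτ⟩ : ∃ τ, τ = Real.sqrt (1 - σ ^ 2) := ⟨_, rfl⟩
  have hτ2 : τ ^ 2 = 1 - σ ^ 2 := by rw [hτ, Real.sq_sqrt (by linarith)]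
  obtain ⟨δ, hδ⟩ : ∃ δ, δ = 1 + β * (1 - σ ^ 2) := ⟨_, rfl⟩
  have h1 : 0 < δ := by rw [hδ, ← hτ2]; positivity
  have hcoef : 1 + (D / δ - 1) = D / δ := by ring
  rw [gaussPair, lintegral_map (by fun_prop) (by fun_prop), ← hτ,
    lintegral_prod _ (by fun_prop)]
  have hinner : ∀ x : ℝ, ∫⁻ z, ENNReal.ofReal (Real.exp
        (-(α * x ^ 2 - 2 * q * x * (σ * x + τ * z) + β * (σ * x + τ * z) ^ 2) / 2
          + u * x + v * (σ * x + τ * z) + k)) ∂stdGauss =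
      ENNReal.ofReal (Real.sqrt δ)⁻¹ * ENNReal.ofReal (Real.exp
        (-(D / δ - 1) / 2 * x ^ 2
          + (u + σ * v + (1 - σ ^ 2) * (q - β * σ) * v / δ) * x
          + ((1 - σ ^ 2) * v ^ 2 / (2 * δ) + k))) := by
    intro x
    rw [← ENNReal.ofReal_mul (by positivity)]
    refine (lintegral_congr fun z => ?_).trans
      ((lintegral_exp_quadratic_stdGauss (a := β * (1 - σ ^ 2)) (τ * ((q - β * σ) * x + v))
        (-(α * x ^ 2 - 2 * q * x * (σ * x) + β * (σ * x) ^ 2) / 2 + u * x + v * (σ * x) + k)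
        (hδ ▸ h1)).trans ?_)
    · rw [← hτ2]
      congr 2
      ring
    · rw [← hδ]
      congr 2
      apply congrArg Real.exp
      rw [mul_pow, hτ2]
      field_simp
      simp only [hDeq, hδ]
      ring
  simp only [hinner]
  rw [lintegral_const_mul _ (by fun_prop), lintegral_exp_quadratic_stdGauss _ _
    (by rw [hcoef]; positivity), hcoef, ← ENNReal.ofReal_mul (by positivity), ← mul_assoc,
    ← mul_inv, ← Real.sqrt_mul h1.le, mul_div_cancel₀ _ h1.ne']
  congr 2
  apply congrArg Real.exp
  field_simp
  simp only [hDeq, hδ]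
  ring

theorem lintegral_pi_insertNth {X : Type*} [MeasurableSpace X] (μ : Measure X) [SigmaFinite μ]
    {n : ℕ} (p : Fin (n + 1)) {f : (Fin (n + 1) → X) → ENNReal} (hf : Measurable f) :
    ∫⁻ ω, f ω ∂(Measure.pi fun _ => μ) =
      ∫⁻ a, ∫⁻ w, f (p.insertNth a w) ∂(Measure.pi fun _ : Fin n => μ) ∂μ := by
  have h := (measurePreserving_piFinSuccAbove (fun _ : Fin (n + 1) => μ) p).symm
  rw [← h.lintegral_comp hf,
    lintegral_prod (fun z => f ((MeasurableEquiv.piFinSuccAbove (fun _ => X) p).symm z))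
      (hf.comp (MeasurableEquiv.measurable _)).aemeasurable]
  rfl

/-- Sum of the squared differences along a path of pairs with prescribed end pairs. -/
def chainSum {n : ℕ} (a : ℝ × ℝ) (w : Fin n → ℝ × ℝ) (b : ℝ × ℝ) : ℝ :=
  ∑ i : Fin (n + 1), (((Fin.cons a w : Fin (n + 1) → ℝ × ℝ) i).1 -
    ((Fin.snoc w b : Fin (n + 1) → ℝ × ℝ) i).2) ^ 2

@[fun_prop]
theorem measurable_chainSum {n : ℕ} (a b : ℝ × ℝ) :
    Measurable fun w : Fin n → ℝ × ℝ => chainSum a w b := by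
  unfold chainSum
  refine Finset.measurable_sum _ fun i _ => ?_
  have hcons : Measurable fun w : Fin n → ℝ × ℝ => (Fin.cons a w : Fin (n + 1) → ℝ × ℝ) i := by
    refine Fin.cases ?_ (fun j => ?_) i
    · simp
    · simpa using measurable_pi_apply j
  have hsnoc : Measurable fun w : Fin n → ℝ × ℝ => (Fin.snoc w b : Fin (n + 1) → ℝ × ℝ) i := by
    refine Fin.lastCases ?_ (fun j => ?_) i
    · simp
    · simpa using measurable_pi_apply j
  exact (hcons.fst.sub hsnoc.snd).pow_const 2

theorem chainSum_zero (a b : ℝ × ℝ) (w : Fin 0 → ℝ × ℝ) :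
    chainSum a w b = (a.1 - b.2) ^ 2 := by
  simp [chainSum, Fin.snoc]

theorem chainSum_cons {n : ℕ} (a b c : ℝ × ℝ) (w : Fin n → ℝ × ℝ) :
    chainSum a (Fin.cons c w : Fin (n + 1) → ℝ × ℝ) b = (a.1 - c.2) ^ 2 + chainSum c w b := by
  rw [chainSum, Fin.sum_univ_succ, chainSum]
  simp_rw [← Fin.cons_snoc_eq_snoc_cons, Fin.cons_succ, Fin.cons_zero]

theorem sum_cycle_eq_chainSum {n : ℕ} (a : ℝ × ℝ) (w : Fin n → ℝ × ℝ) :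
    ∑ i : Fin (n + 1), (((Fin.cons a w : Fin (n + 1) → ℝ × ℝ) i).1 -
      ((Fin.cons a w : Fin (n + 1) → ℝ × ℝ) (finRotate (n + 1) i)).2) ^ 2 = chainSum a w a := by
  rw [chainSum, Fin.snoc_eq_cons_rotate]

theorem sum_path_eq_chainSum {n : ℕ} (a b : ℝ × ℝ) (w : Fin n → ℝ × ℝ) :
    ∑ i : Fin (n + 1),
      (((Fin.cons a (Fin.snoc w b : Fin (n + 1) → ℝ × ℝ) : Fin (n + 2) → ℝ × ℝ) i.castSucc).1 -
        ((Fin.cons a (Fin.snoc w b : Fin (n + 1) → ℝ × ℝ) : Fin (n + 2) → ℝ × ℝ) i.succ).2) ^ 2 =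
      chainSum a w b := by
  simp_rw [chainSum, Fin.cons_succ, Fin.cons_snoc_eq_snoc_cons, Fin.snoc_castSucc]

/-- Numerators `(E, N, K)` describing the Gaussian kernel left after integrating out the interior
pairs of a chain: `E` is the determinant, `N / E` the diagonal quadratic coefficient and `K / E`
the determinant of the quadratic form. -/
noncomputable def chainCoef (ρ t : ℝ) : ℕ → ℝ × ℝ × ℝ
  | 0 => (1, t, 0)
  | n + 1 =>
    ((1 + t) * (chainCoef ρ t n).1 + (1 + (1 - ρ ^ 2) * t) * (chainCoef ρ t n).2.1,
      t * ((chainCoef ρ t n).1 + (chainCoef ρ t n).2.1),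
      t * ((chainCoef ρ t n).2.2 + (chainCoef ρ t n).2.1))

theorem chainCoef_pos {ρ t : ℝ} (hρ : ρ ^ 2 ≤ 1) (ht : 0 < t) (n : ℕ) :
    0 < (chainCoef ρ t n).1 ∧ 0 < (chainCoef ρ t n).2.1 ∧ 0 ≤ (chainCoef ρ t n).2.2 := by
  have hκ : 0 ≤ 1 - ρ ^ 2 := by linarith
  induction n with
  | zero => simp [chainCoef, ht]
  | succ n ih =>
    obtain ⟨h1, h2, h3⟩ := ih
    simp only [chainCoef]
    refine ⟨?_, ?_, ?_⟩ <;> positivity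

theorem chainCoef_rel (ρ t : ℝ) (n : ℕ) :
    (1 + (1 - ρ ^ 2) * t) * (chainCoef ρ t n).2.2 =
      t * (chainCoef ρ t n).1 - (chainCoef ρ t n).2.1 := by
  induction n with
  | zero => simp [chainCoef]
  | succ n ih =>
    simp only [chainCoef]
    linear_combination t * ih

theorem chainCoef_disc (ρ t : ℝ) (n : ℕ) :
    (chainCoef ρ t n).2.1 ^ 2 - (t * (ρ * t) ^ n) ^ 2 =
      (chainCoef ρ t n).2.2 * (chainCoef ρ t n).1 := by
  induction n with
  | zero => simp [chainCoef]
  | succ n ih =>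
    have h := chainCoef_rel ρ t n
    simp only [chainCoef]
    linear_combination ρ ^ 2 * t ^ 2 * ih -
      t * ((chainCoef ρ t n).1 + (chainCoef ρ t n).2.1) * h

/-- Integrating out the interior pairs of a chain leaves a Gaussian kernel in the endpoints. -/
theorem lintegral_exp_chainSum {ρ t : ℝ} (hρ : ρ ^ 2 ≤ 1) (ht : 0 < t) (n : ℕ) (a b : ℝ × ℝ) :
    ∫⁻ w : Fin n → ℝ × ℝ, ENNReal.ofReal (Real.exp (-(t / 2) * chainSum a w b))
        ∂(Measure.pi fun _ => gaussPair ρ) =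
      ENNReal.ofReal ((Real.sqrt (chainCoef ρ t n).1)⁻¹ * Real.exp
        (-((chainCoef ρ t n).2.1 * a.1 ^ 2 - 2 * (t * (ρ * t) ^ n) * a.1 * b.2
          + (chainCoef ρ t n).2.1 * b.2 ^ 2) / (2 * (chainCoef ρ t n).1))) := by
  induction n generalizing a with
  | zero =>
    simp only [chainSum_zero, lintegral_const, measure_univ, mul_one, chainCoef, Real.sqrt_one,
      inv_one, one_mul, pow_zero]
    congr 2
    ring
  | succ n ih =>
    rw [lintegral_pi_insertNth (gaussPair ρ) 0 (by fun_prop)]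
    simp only [Fin.insertNth_zero', chainSum_cons, mul_add, Real.exp_add,
      ENNReal.ofReal_mul (Real.exp_pos _).le]
    have hmeas (c : ℝ × ℝ) : Measurable fun w : Fin n → ℝ × ℝ =>
        ENNReal.ofReal (Real.exp (-(t / 2) * chainSum c w b)) := by fun_prop
    refine (lintegral_congr fun c => lintegral_const_mul _ (hmeas c)).trans ?_
    simp_rw [ih]
    obtain ⟨hE, hN, hK⟩ := chainCoef_pos hρ ht n
    obtain ⟨hE', -, -⟩ := chainCoef_pos hρ ht (n + 1)
    have hrel := chainCoef_rel ρ t n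
    have hdisc := chainCoef_disc ρ t n
    simp only [chainCoef] at hE' ⊢
    generalize (chainCoef ρ t n).1 = E at *
    generalize (chainCoef ρ t n).2.1 = N at *
    generalize (chainCoef ρ t n).2.2 = K at *
    rw [pow_succ (ρ * t) n, ← mul_assoc t]
    generalize t * (ρ * t) ^ n = Q at *
    obtain ⟨E', hE'eq⟩ : ∃ E', E' = (1 + t) * E + (1 + (1 - ρ ^ 2) * t) * N := ⟨_, rfl⟩
    rw [← hE'eq] at hE' ⊢
    have hstep : Q ^ 2 * (1 + (1 - ρ ^ 2) * t) = N * E' - t * (E + N) * E := by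
      rw [hE'eq]
      linear_combination -E * hrel - (1 + (1 - ρ ^ 2) * t) * hdisc
    have hint : ∀ c : ℝ × ℝ, ENNReal.ofReal (Real.exp (-(t / 2) * (a.1 - c.2) ^ 2)) *
        ENNReal.ofReal ((Real.sqrt E)⁻¹ * Real.exp
          (-(N * c.1 ^ 2 - 2 * Q * c.1 * b.2 + N * b.2 ^ 2) / (2 * E))) =
        ENNReal.ofReal (Real.sqrt E)⁻¹ * ENNReal.ofReal (Real.exp
          (-(N / E * c.1 ^ 2 - 2 * 0 * c.1 * c.2 + t * c.2 ^ 2) / 2 + Q * b.2 / E * c.1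
            + t * a.1 * c.2 + (-t * a.1 ^ 2 / 2 - N * b.2 ^ 2 / (2 * E)))) := by
      intro c
      rw [← ENNReal.ofReal_mul (by positivity), ← ENNReal.ofReal_mul (by positivity),
        mul_left_comm, ← Real.exp_add]
      congr 3
      field_simp
      ring
    simp_rw [hint]
    rw [lintegral_const_mul _ (by fun_prop), lintegral_exp_quadratic_gaussPair (D := E' / E) _ _ _
      hρ ht.le (by positivity) (by rw [hE'eq]; field_simp; ring),
      ← ENNReal.ofReal_mul (by positivity), ← mul_assoc, ← mul_inv, ← Real.sqrt_mul hE.le,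
      mul_div_cancel₀ _ hE.ne']
    congr 2
    apply congrArg Real.exp
    field_simp
    linear_combination b.2 ^ 2 * hstep - E * t * a.1 ^ 2 * hE'eq

theorem integral_exp_eq_toReal_lintegral {X : Type*} [MeasurableSpace X] (μ : Measure X)
    {f : X → ℝ} (hf : Measurable f) :
    ∫ x, Real.exp (f x) ∂μ = (∫⁻ x, ENNReal.ofReal (Real.exp (f x)) ∂μ).toReal :=
  integral_eq_lintegral_of_nonneg_ae (Filter.Eventually.of_forall fun _ => (Real.exp_pos _).le)
    hf.exp.aestronglyMeasurable

theorem integral_exp_sq_sub_gaussPair {σ t : ℝ} (hσ : σ ^ 2 ≤ 1) (ht : 0 < t) :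
    ∫ z : ℝ × ℝ, Real.exp (-(t / 2) * (z.1 - z.2) ^ 2) ∂(gaussPair σ) =
      (Real.sqrt (1 + 2 * t * (1 - σ)))⁻¹ := by
  have hpos : 0 < 1 + 2 * t * (1 - σ) := by
    have : 0 ≤ 1 - σ := by nlinarith
    positivity
  rw [integral_exp_eq_toReal_lintegral _ (by fun_prop)]
  have h := lintegral_exp_quadratic_gaussPair (α := t) (q := t) 0 0 0 hσ ht.le hpos (by ring)
  rw [← ENNReal.toReal_ofReal (r := (Real.sqrt _)⁻¹) (by positivity)]
  congr 1
  refine (lintegral_congr fun z => ?_).trans (h.trans ?_)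
  · congr 2
    ring
  · simp

theorem chainCoef_cycle_pos {ρ t : ℝ} (hρ : 0 < ρ) (hρ1 : ρ < 1) (ht : 0 < t) (n : ℕ) :
    0 < (chainCoef ρ t n).1 + 2 * (chainCoef ρ t n).2.1 - 2 * ρ * (t * (ρ * t) ^ n) +
      (1 - ρ ^ 2) * (chainCoef ρ t n).2.2 := by
  have hρ2 : ρ ^ 2 ≤ 1 := by nlinarith
  obtain ⟨hE, hN, hK⟩ := chainCoef_pos hρ2 ht n
  have hdisc := chainCoef_disc ρ t n
  have hQ : t * (ρ * t) ^ n ≤ (chainCoef ρ t n).2.1 := by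
    refine le_of_pow_le_pow_left₀ two_ne_zero hN.le ?_
    nlinarith [mul_nonneg hK hE.le]
  have hQ0 : 0 < t * (ρ * t) ^ n := by positivity
  have hρ3 : 0 ≤ 1 - ρ ^ 2 := by linarith
  nlinarith [mul_nonneg hρ3 hK]

theorem sqCycleMGF_succ {ρ t : ℝ} (hρ : 0 < ρ) (hρ1 : ρ < 1) (ht : 0 < t) (n : ℕ) :
    sqCycleMGF ρ t (n + 1) =
      (Real.sqrt ((chainCoef ρ t n).1 + 2 * (chainCoef ρ t n).2.1 - 2 * ρ * (t * (ρ * t) ^ n) +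
        (1 - ρ ^ 2) * (chainCoef ρ t n).2.2))⁻¹ := by
  have hρ2 : ρ ^ 2 ≤ 1 := by nlinarith
  have hpos := chainCoef_cycle_pos hρ hρ1 ht n
  rw [sqCycleMGF, integral_exp_eq_toReal_lintegral _ (by fun_prop),
    lintegral_pi_insertNth (gaussPair ρ) 0 (by fun_prop)]
  simp only [Fin.insertNth_zero', sum_cycle_eq_chainSum, lintegral_exp_chainSum hρ2 ht]
  obtain ⟨hE, hN, hK⟩ := chainCoef_pos hρ2 ht n
  have hdisc := chainCoef_disc ρ t n
  generalize (chainCoef ρ t n).1 = E at *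
  generalize (chainCoef ρ t n).2.1 = N at *
  generalize (chainCoef ρ t n).2.2 = K at *
  generalize t * (ρ * t) ^ n = Q at *
  have hD : (E + 2 * N - 2 * ρ * Q + (1 - ρ ^ 2) * K) / E =
      1 + N / E + N / E - 2 * ρ * (Q / E) +
        (1 - ρ ^ 2) * (N / E * (N / E) - (Q / E) ^ 2) := by
    field_simp
    linear_combination -(1 - ρ ^ 2) * hdisc
  have h := lintegral_exp_quadratic_gaussPair 0 0 0 hρ2 (by positivity) (by positivity) hD
  rw [← ENNReal.toReal_ofReal (r := (Real.sqrt (E + 2 * N - 2 * ρ * Q + (1 - ρ ^ 2) * K))⁻¹)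
    (by positivity)]
  congr 1
  simp_rw [ENNReal.ofReal_mul (inv_nonneg.2 (Real.sqrt_nonneg E))]
  rw [lintegral_const_mul _ (by fun_prop),
    ← mul_div_cancel₀ (E + 2 * N - 2 * ρ * Q + (1 - ρ ^ 2) * K) hE.ne', Real.sqrt_mul hE.le,
    mul_inv, ENNReal.ofReal_mul (by positivity)]
  congr 1
  refine (lintegral_congr fun z => ?_).trans (h.trans ?_)
  · congr 2
    field_simp
    ring
  · simp

theorem sqPathMGF_succ {ρ t : ℝ} (hρ : ρ ^ 2 ≤ 1) (ht : 0 < t) (n : ℕ) :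
    sqPathMGF ρ t (n + 1) =
      (Real.sqrt ((chainCoef ρ t n).1 + 2 * (chainCoef ρ t n).2.1 + (chainCoef ρ t n).2.2))⁻¹ := by
  rw [sqPathMGF, integral_exp_eq_toReal_lintegral _ (by fun_prop),
    lintegral_pi_insertNth (gaussPair ρ) 0 (by fun_prop)]
  simp only [Fin.insertNth_zero']
  have hlast (a : ℝ × ℝ) : ∫⁻ w : Fin (n + 1) → ℝ × ℝ, ENNReal.ofReal (Real.exp (-(t / 2) *
        ∑ i : Fin (n + 1), (((Fin.cons a w : Fin (n + 2) → ℝ × ℝ) i.castSucc).1 -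
          ((Fin.cons a w : Fin (n + 2) → ℝ × ℝ) i.succ).2) ^ 2))
        ∂(Measure.pi fun _ => gaussPair ρ) =
      ∫⁻ b, ∫⁻ w : Fin n → ℝ × ℝ, ENNReal.ofReal (Real.exp (-(t / 2) * chainSum a w b))
        ∂(Measure.pi fun _ => gaussPair ρ) ∂gaussPair ρ := by
    rw [lintegral_pi_insertNth (gaussPair ρ) (Fin.last n)]
    · simp only [Fin.insertNth_last', sum_path_eq_chainSum]
    · have hcons (i : Fin (n + 2)) : Measurable fun w : Fin (n + 1) → ℝ × ℝ =>
          (Fin.cons a w : Fin (n + 2) → ℝ × ℝ) i := by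
        refine Fin.cases ?_ (fun j => ?_) i
        · simp
        · simpa using measurable_pi_apply j
      fun_prop
  simp only [hlast, lintegral_exp_chainSum hρ ht]
  obtain ⟨hE, hN, hK⟩ := chainCoef_pos hρ ht n
  have hdisc := chainCoef_disc ρ t n
  generalize (chainCoef ρ t n).1 = E at *
  generalize (chainCoef ρ t n).2.1 = N at *
  generalize (chainCoef ρ t n).2.2 = K at *
  generalize t * (ρ * t) ^ n = Q at *
  have hinner (a : ℝ × ℝ) : ∫⁻ b, ENNReal.ofReal ((Real.sqrt E)⁻¹ * Real.exp
        (-(N * a.1 ^ 2 - 2 * Q * a.1 * b.2 + N * b.2 ^ 2) / (2 * E))) ∂gaussPair ρ =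
      ENNReal.ofReal (Real.sqrt (E + N))⁻¹ * ENNReal.ofReal (Real.exp
        (-((N + K) / (E + N) * a.1 ^ 2 - 2 * 0 * a.1 * a.2 + 0 * a.2 ^ 2) / 2
          + 0 * a.1 + 0 * a.2 + 0)) := by
    have h := lintegral_exp_quadratic_gaussPair (α := 0) (β := N / E) (q := 0)
      (D := (E + N) / E) 0 (Q * a.1 / E) (-N * a.1 ^ 2 / (2 * E)) hρ (by positivity)
      (by positivity) (by field_simp; ring)
    simp_rw [ENNReal.ofReal_mul (inv_nonneg.2 (Real.sqrt_nonneg E))]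
    have hsqrt : Real.sqrt (E + N) = Real.sqrt E * Real.sqrt ((E + N) / E) := by
      rw [← Real.sqrt_mul hE.le, mul_div_cancel₀ _ hE.ne']
    rw [lintegral_const_mul _ (by fun_prop), hsqrt, mul_inv, ENNReal.ofReal_mul (by positivity),
      mul_assoc (ENNReal.ofReal _)]
    congr 1
    refine (lintegral_congr fun z => ?_).trans (h.trans ?_)
    · congr 2
      field_simp
      ring
    · rw [ENNReal.ofReal_mul (by positivity)]
      congr 2
      apply congrArg Real.exp
      field_simp
      linear_combination -a.1 ^ 2 * hdisc
  simp_rw [hinner]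
  rw [lintegral_const_mul _ (by fun_prop), lintegral_exp_quadratic_gaussPair
    (D := (E + 2 * N + K) / (E + N)) 0 0 0 hρ le_rfl (by positivity) (by field_simp; ring),
    ← ENNReal.ofReal_mul (by positivity), ENNReal.toReal_ofReal (by positivity)]
  have hsqrt := Real.sqrt_mul (x := E + N) (by positivity) ((E + 2 * N + K) / (E + N))
  rw [mul_div_cancel₀ _ (by positivity)] at hsqrt
  rw [hsqrt, mul_inv]
  simp

theorem chainCoef_trace {ρ t l₁ l₂ : ℝ} (hs : l₁ + l₂ = 1 + 2 * t) (hp : l₁ * l₂ = t ^ 2 * ρ ^ 2)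
    (n : ℕ) :
    (chainCoef ρ t n).1 + 2 * (chainCoef ρ t n).2.1 + (1 - ρ ^ 2) * (chainCoef ρ t n).2.2 =
      l₁ ^ (n + 1) + l₂ ^ (n + 1) := by
  induction n using Nat.twoStepInduction with
  | zero =>
    simp only [chainCoef]
    linear_combination -hs
  | one =>
    simp only [chainCoef]
    linear_combination 2 * hp - (l₁ + l₂ + 1 + 2 * t) * hs
  | more n ih ih' =>
    have hpow : l₁ ^ (n + 2 + 1) + l₂ ^ (n + 2 + 1) =
        (l₁ + l₂) * (l₁ ^ (n + 1 + 1) + l₂ ^ (n + 1 + 1)) -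
          l₁ * l₂ * (l₁ ^ (n + 1) + l₂ ^ (n + 1)) := by ring
    rw [hpow, ← ih, ← ih', hs, hp]
    simp only [chainCoef]
    linear_combination -(1 - ρ ^ 2) * t * chainCoef_rel ρ t n

theorem sqCycleMGF_eq_rpow {ρ t l₁ l₂ : ℝ} (hρ : 0 < ρ) (hρ1 : ρ < 1) (ht : 0 < t)
    (hl : l₂ < l₁) (hl₂ : 0 < l₂) (hs : l₁ + l₂ = 1 + 2 * t) (hp : l₁ * l₂ = t ^ 2 * ρ ^ 2)
    {ℓ : ℕ} (hℓ : 1 ≤ ℓ) :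
    sqCycleMGF ρ t ℓ = (l₁ ^ ((ℓ : ℝ) / 2) - l₂ ^ ((ℓ : ℝ) / 2))⁻¹ := by
  obtain ⟨n, rfl⟩ := Nat.exists_eq_add_of_le' hℓ
  have hl₁ : 0 < l₁ := hl₂.trans hl
  have hsq {x : ℝ} (hx : 0 < x) : (x ^ (((n + 1 : ℕ) : ℝ) / 2)) ^ 2 = x ^ (n + 1) := by
    rw [← Real.rpow_mul_natCast hx.le, ← Real.rpow_natCast x (n + 1)]
    congr 1
    push_cast
    ring
  have hmul : l₁ ^ (((n + 1 : ℕ) : ℝ) / 2) * l₂ ^ (((n + 1 : ℕ) : ℝ) / 2) =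
      (ρ * t) ^ (n + 1) := by
    rw [← Real.mul_rpow hl₁.le hl₂.le, hp, show t ^ 2 * ρ ^ 2 = (ρ * t) ^ 2 by ring,
      ← Real.rpow_natCast_mul (by positivity), ← Real.rpow_natCast]
    congr 1
    push_cast
    ring
  have hnonneg : 0 ≤ l₁ ^ (((n + 1 : ℕ) : ℝ) / 2) - l₂ ^ (((n + 1 : ℕ) : ℝ) / 2) :=
    sub_nonneg.2 (Real.rpow_le_rpow hl₂.le hl.le (by positivity))
  rw [sqCycleMGF_succ hρ hρ1 ht, ← Real.sqrt_sq hnonneg]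
  congr 2
  linear_combination chainCoef_trace hs hp n - hsq hl₁ - hsq hl₂ + 2 * hmul

theorem sqPathMGF_lt_sqCycleMGF {ρ t : ℝ} (hρ : 0 < ρ) (hρ1 : ρ < 1) (ht : 0 < t) {ℓ : ℕ}
    (hℓ : 1 ≤ ℓ) : sqPathMGF ρ t ℓ < sqCycleMGF ρ t ℓ := by
  obtain ⟨n, rfl⟩ := Nat.exists_eq_add_of_le' hℓ
  have hρ2 : ρ ^ 2 ≤ 1 := by nlinarith
  obtain ⟨-, -, hK⟩ := chainCoef_pos hρ2 ht n
  have hpos := chainCoef_cycle_pos hρ hρ1 ht n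
  have hQ : 0 < 2 * ρ * (t * (ρ * t) ^ n) := by positivity
  rw [sqPathMGF_succ hρ2 ht, sqCycleMGF_succ hρ hρ1 ht]
  refine inv_strictAnti₀ (Real.sqrt_pos.2 hpos) (Real.sqrt_lt_sqrt hpos.le ?_)
  nlinarith [mul_nonneg (sq_nonneg ρ) hK]

theorem sqCycleMGF_one {ρ t : ℝ} (hρ : 0 < ρ) (hρ1 : ρ < 1) (ht : 0 < t) :
    sqCycleMGF ρ t 1 = (Real.sqrt (1 + 2 * t * (1 - ρ)))⁻¹ := by
  rw [sqCycleMGF_succ hρ hρ1 ht 0]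
  congr 2
  simp only [chainCoef]
  ring

theorem sqCycleMGF_two {ρ t : ℝ} (hρ : 0 < ρ) (hρ1 : ρ < 1) (ht : 0 < t) :
    sqCycleMGF ρ t 2 = (Real.sqrt ((1 + 2 * t) ^ 2 - 4 * t ^ 2 * ρ ^ 2))⁻¹ := by
  rw [sqCycleMGF_succ hρ hρ1 ht 1]
  congr 2
  simp only [chainCoef]
  ring

theorem integral_exp_cross_eq_sqCycleMGF_two (ρ t : ℝ) :
    ∫ z : (ℝ × ℝ) × (ℝ × ℝ),
        Real.exp (-(t / 2) * ((z.1.1 - z.2.2) ^ 2 + (z.2.1 - z.1.2) ^ 2))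
        ∂((gaussPair ρ).prod (gaussPair ρ)) = sqCycleMGF ρ t 2 := by
  rw [sqCycleMGF, integral_exp_eq_toReal_lintegral _ (by fun_prop),
    integral_exp_eq_toReal_lintegral _ (by fun_prop), lintegral_prod _ (by fun_prop),
    lintegral_pi_insertNth (gaussPair ρ) 0 (by fun_prop)]
  simp only [Fin.insertNth_zero', sum_cycle_eq_chainSum]
  congr 1
  refine lintegral_congr fun a => ?_
  rw [lintegral_pi_insertNth (gaussPair ρ) 0 (by fun_prop)]
  simp [chainSum_cons, chainSum_zero]

/-- **Lemma 2.1, Gaussian Wigner case with `f(x,y) = −(1/2)(x−y)²`**: closed forms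
(a) for one correlated pair, one independent pair and two crossed correlated pairs,
and (b) the path/cycle MGF inequalities together with the closed form of the cycle MGF in
terms of the roots `λ₁ > λ₂ > 0` of `x² − (1+2t)x + t²ρ² = 0`. -/
theorem gauss_sq_mgf (ρ t : ℝ) (hρ : 0 < ρ) (hρ1 : ρ < 1) (ht : 0 < t) :
    (∫ z : ℝ × ℝ, Real.exp (-(t / 2) * (z.1 - z.2) ^ 2) ∂(gaussPair ρ) =
      (Real.sqrt (1 + 2 * t * (1 - ρ)))⁻¹) ∧
    (∫ z : ℝ × ℝ, Real.exp (-(t / 2) * (z.1 - z.2) ^ 2) ∂(stdGauss.prod stdGauss) =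
      (Real.sqrt (1 + 2 * t))⁻¹) ∧
    (∫ z : (ℝ × ℝ) × (ℝ × ℝ),
        Real.exp (-(t / 2) * ((z.1.1 - z.2.2) ^ 2 + (z.2.1 - z.1.2) ^ 2))
        ∂((gaussPair ρ).prod (gaussPair ρ)) =
      (Real.sqrt ((1 + 2 * t) ^ 2 - 4 * t ^ 2 * ρ ^ 2))⁻¹) ∧
    (sqPathMGF ρ t 1) ^ 2 ≤ sqCycleMGF ρ t 2 ∧
    sqCycleMGF ρ t 2 ≤ (sqCycleMGF ρ t 1) ^ 2 ∧
    (∀ ℓ : ℕ, 1 ≤ ℓ → sqPathMGF ρ t ℓ < sqCycleMGF ρ t ℓ) ∧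
    (∀ ℓ : ℕ, 2 ≤ ℓ → (sqCycleMGF ρ t ℓ) ^ 2 ≤ (sqCycleMGF ρ t 2) ^ ℓ) ∧
    (∃ l₁ l₂ : ℝ, l₂ < l₁ ∧ 0 < l₂ ∧
      l₁ ^ 2 - (1 + 2 * t) * l₁ + t ^ 2 * ρ ^ 2 = 0 ∧
      l₂ ^ 2 - (1 + 2 * t) * l₂ + t ^ 2 * ρ ^ 2 = 0 ∧
      ∀ ℓ : ℕ, 1 ≤ ℓ →
        sqCycleMGF ρ t ℓ = (l₁ ^ ((ℓ : ℝ) / 2) - l₂ ^ ((ℓ : ℝ) / 2))⁻¹) := by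
  have hρ2 : ρ ^ 2 < 1 := by nlinarith
  have hκ : 0 < 1 - ρ := by linarith
  have hdisc : 0 < (1 + 2 * t) ^ 2 - 4 * t ^ 2 * ρ ^ 2 := by
    have : t ^ 2 * ρ ^ 2 ≤ t ^ 2 * 1 := by gcongr
    nlinarith
  obtain ⟨d, hd⟩ : ∃ d, d = Real.sqrt ((1 + 2 * t) ^ 2 - 4 * t ^ 2 * ρ ^ 2) := ⟨_, rfl⟩
  have hd0 : 0 < d := hd ▸ Real.sqrt_pos.2 hdisc
  have hd2 : d ^ 2 = (1 + 2 * t) ^ 2 - 4 * t ^ 2 * ρ ^ 2 := by rw [hd, Real.sq_sqrt hdisc.le]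
  have hds : d < 1 + 2 * t := by
    refine lt_of_pow_lt_pow_left₀ 2 (by positivity) ?_
    rw [hd2]
    have : 0 < 4 * t ^ 2 * ρ ^ 2 := by positivity
    linarith
  have hl : (1 + 2 * t - d) / 2 < (1 + 2 * t + d) / 2 := by linarith
  have hl₂ : 0 < (1 + 2 * t - d) / 2 := by linarith
  have hroot (ℓ : ℕ) (hℓ : 1 ≤ ℓ) := sqCycleMGF_eq_rpow hρ hρ1 ht hl hl₂ (by ring)
    (by linear_combination -hd2 / 4) hℓ
  have htwo := sqCycleMGF_two hρ hρ1 ht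
  refine ⟨integral_exp_sq_sub_gaussPair hρ2.le ht, ?_, ?_, ?_, ?_,
    fun ℓ hℓ => sqPathMGF_lt_sqCycleMGF hρ hρ1 ht hℓ, fun ℓ hℓ => ?_,
    (1 + 2 * t + d) / 2, (1 + 2 * t - d) / 2, hl, hl₂, ?_, ?_, hroot⟩
  · rw [← gaussPair_zero, integral_exp_sq_sub_gaussPair (by norm_num) ht, sub_zero, mul_one]
  · rw [integral_exp_cross_eq_sqCycleMGF_two, htwo]
  · rw [sqPathMGF_succ hρ2.le ht 0, htwo, inv_pow, Real.sq_sqrt (by simp [chainCoef]; positivity)]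
    refine inv_anti₀ (Real.sqrt_pos.2 hdisc) (Real.sqrt_le_iff.2 ?_)
    simp only [chainCoef]
    constructor
    · positivity
    · nlinarith [sq_nonneg (t * ρ)]
  · rw [htwo, sqCycleMGF_one hρ hρ1 ht, inv_pow, Real.sq_sqrt (by positivity)]
    refine inv_anti₀ (by positivity) (Real.le_sqrt_of_sq_le ?_)
    nlinarith [mul_pos ht hρ, mul_pos (mul_pos ht hρ) hκ, mul_pos (mul_pos (mul_pos ht ht) hρ) hκ]
  · have hp : 1 ≤ (ℓ : ℝ) / 2 := by
      have : (2 : ℝ) ≤ ℓ := by exact_mod_cast hℓ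
      linarith
    have hsuper := Real.add_rpow_le_rpow_add hd0.le hl₂.le hp
    rw [show d + (1 + 2 * t - d) / 2 = (1 + 2 * t + d) / 2 by ring] at hsuper
    rw [hroot ℓ (by omega), htwo, ← hd, inv_pow, inv_pow]
    have hsq : (d ^ ((ℓ : ℝ) / 2)) ^ 2 = d ^ ℓ := by
      rw [← Real.rpow_mul_natCast hd0.le, ← Real.rpow_natCast d ℓ]
      congr 1
      push_cast
      ring
    refine inv_anti₀ (by positivity) (hsq ▸ ?_)
    exact pow_le_pow_left₀ (by positivity) (by linarith) 2
  · linear_combination hd2 / 4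
  · linear_combination hd2 / 4

end GaussMGF
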